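/- arXiv:2002.02704 — 3 statements merged into one kernel-verified Lean document; each statement's English description precedes it below -/
import Mathlib

section
/- Let L be a positive integer and fix μ ∈ ℝ, ν ∈ ℝ. On a probability space, let (K_t)_{t≥1} be integrable random L×L matrices and (a_t)_{t≥1}, (b_t)_{t≥1} integrable random vectors in ℝ^L with E[a_t] = E[b_t] for every t. Define recursively θ_0 = 0 and θ_{t+1} = θ_t − μ((K_{t+1} + νI) θ_t + (b_{t+1} − a_{t+1})), and assume that for every t the vector θ_t is independent of the triple (K_{t+1}, a_{t+1}, b_{t+1}), with all products appearing below integrable. Then E[θ_t] = 0 for every t ≥ 0. Moreover, if for each t the random vector a_t is independent of θ_t, then the test statistic g_t = θ_tᵀ a_t satisfies E[g_t] = 0 for every t. -/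
open MeasureTheory ProbabilityTheory Matrix

/-- Unbiasedness of NOUGAT under the null hypothesis: with `θ 0 = 0`,
the recursion `θ_{t+1} = θ_t - μ((K_{t+1} + νI)θ_t + (b_{t+1} - a_{t+1}))` with
`E[a_t] = E[b_t]` and the MIA independence gives `E[θ_t] = 0` for all `t`; moreover,
if `a_t` is independent of `θ_t`, the statistic `g_t = θ_tᵀ a_t` has zero mean. -/
theorem stmt_4 {Ω : Type*} [MeasureSpace Ω] [IsProbabilityMeasure (ℙ : Measure Ω)]
    {L : ℕ} (hL : 0 < L) (μ ν : ℝ)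
    (K : ℕ → Ω → Fin L → Fin L → ℝ) (a b : ℕ → Ω → Fin L → ℝ)
    (hKmeas : ∀ t, Measurable (K t)) (hameas : ∀ t, Measurable (a t))
    (hbmeas : ∀ t, Measurable (b t))
    (hKint : ∀ t, Integrable (K t) ℙ) (haint : ∀ t, Integrable (a t) ℙ)
    (hbint : ∀ t, Integrable (b t) ℙ)
    (hab : ∀ t i, ∫ ω, a t ω i = ∫ ω, b t ω i)
    (θ : ℕ → Ω → Fin L → ℝ)
    (hθ0 : ∀ ω, θ 0 ω = 0)
    (hrec : ∀ t ω, θ (t + 1) ω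
      = θ t ω - μ • ((Matrix.of (K (t+1) ω) + ν • (1 : Matrix (Fin L) (Fin L) ℝ)) *ᵥ θ t ω
          + (b (t+1) ω - a (t+1) ω)))
    (hθint : ∀ t, Integrable (θ t) ℙ)
    (hprodint : ∀ t i j, Integrable (fun ω => K (t+1) ω i j * θ t ω j) ℙ)
    (hindep : ∀ t, IndepFun (θ t) (fun ω => (K (t+1) ω, a (t+1) ω, b (t+1) ω)) ℙ) :
    (∀ t i, ∫ ω, θ t ω i = 0) ∧
    ((∀ t, IndepFun (θ t) (a t) ℙ) →
      (∀ t, Integrable (fun ω => θ t ω ⬝ᵥ a t ω) ℙ) →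
      ∀ t, ∫ ω, θ t ω ⬝ᵥ a t ω = 0) := by
  have hθi (t i) : Integrable (fun ω => θ t ω i) ℙ := (hθint t).eval i
  have hai (t i) : Integrable (fun ω => a t ω i) ℙ := (haint t).eval i
  have hbi (t i) : Integrable (fun ω => b t ω i) ℙ := (hbint t).eval i
  have hKi (t i j) : Integrable (fun ω => K t ω i j) ℙ := ((hKint t).eval i).eval j
  have hmean : ∀ t i, ∫ ω, θ t ω i = 0 := by
    intro t
    induction t with
    | zero => intro i; simp [hθ0]
    | succ t ih =>
      intro i
      have hprod (j) : ∫ ω, K (t + 1) ω i j * θ t ω j = 0 := by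
        have hind : IndepFun (fun ω => K (t + 1) ω i j) (fun ω => θ t ω j) ℙ :=
          (hindep t).symm.comp
            (φ := fun p : (Fin L → Fin L → ℝ) × (Fin L → ℝ) × (Fin L → ℝ) => p.1 i j)
            (ψ := fun x : Fin L → ℝ => x j) (by fun_prop) (by fun_prop)
        rw [hind.integral_fun_mul_eq_mul_integral (hKi _ _ _).aestronglyMeasurable
          (hθi _ _).aestronglyMeasurable, ih, mul_zero]
      have hstep (ω) : θ (t + 1) ω i = θ t ω i - μ * ((∑ j, K (t + 1) ω i j * θ t ω j
          + ν * θ t ω i) + (b (t + 1) ω i - a (t + 1) ω i)) := by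
        rw [hrec, Matrix.add_mulVec, Matrix.smul_mulVec, Matrix.one_mulVec]
        simp [Matrix.mulVec, dotProduct, mul_add]
      have hsum : Integrable (fun ω => ∑ j, K (t + 1) ω i j * θ t ω j) ℙ :=
        integrable_finsetSum _ fun j _ => hprodint t i j
      have hνθ : Integrable (fun ω => ν * θ t ω i) ℙ := (hθi t i).const_mul ν
      have hdrift : Integrable (fun ω => ∑ j, K (t + 1) ω i j * θ t ω j + ν * θ t ω i) ℙ :=
        hsum.add hνθ
      have hdiff : Integrable (fun ω => b (t + 1) ω i - a (t + 1) ω i) ℙ :=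
        (hbi _ i).sub (hai _ i)
      have hincr : Integrable (fun ω => μ * ((∑ j, K (t + 1) ω i j * θ t ω j + ν * θ t ω i)
          + (b (t + 1) ω i - a (t + 1) ω i))) ℙ :=
        (hdrift.add hdiff).const_mul μ
      simp_rw [hstep]
      rw [integral_sub (hθi t i) hincr, integral_const_mul,
        integral_add hdrift hdiff, integral_add hsum hνθ, integral_const_mul,
        integral_sub (hbi _ i) (hai _ i), integral_finsetSum _ fun j _ => hprodint t i j]
      simp [hprod, ih, hab]
  refine ⟨hmean, fun hind _ t => ?_⟩
  have hindi (i) : IndepFun (fun ω => θ t ω i) (fun ω => a t ω i) ℙ :=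
    (hind t).comp (measurable_pi_apply i) (measurable_pi_apply i)
  have hmul (i) : Integrable (fun ω => θ t ω i * a t ω i) ℙ :=
    (hindi i).integrable_mul (hθi t i) (hai t i)
  simp only [dotProduct]
  rw [integral_finsetSum _ fun i _ => hmul i]
  refine Finset.sum_eq_zero fun i _ => ?_
  rw [(hindi i).integral_fun_mul_eq_mul_integral (hθi t i).aestronglyMeasurable
    (hai t i).aestronglyMeasurable, hmean, zero_mul]
end

section
/- Let L, N be positive integers, ν > 0, let H be a real symmetric positive semidefinite L×L matrix, let Γ be a real (L²)×(L²) matrix, and let q, v ∈ ℝ^{L²}. For μ ∈ ℝ define S(μ) = (1 − μν)² I + (μ²/N)(Γ + (N − 1) H ⊗ H) − μ(1 − μν)(H ⊗ I + I ⊗ H) as an (L²)×(L²) matrix (indices identified with pairs). Then: (i) the matrix 2νI + H ⊗ I + I ⊗ H is invertible; (ii) there exists μ₀ > 0 such that I − S(μ) is invertible for all 0 < μ < μ₀; and (iii) lim_{μ → 0⁺} (1/μ) · vᵀ ( μ² (I − S(μ))⁻¹ q ) = vᵀ (2νI + H ⊗ I + I ⊗ H)⁻¹ q. -/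
open Matrix Filter
open scoped Kronecker

/-- Matrix inversion over a topological field is continuous at every invertible matrix. -/
theorem Matrix.continuousAt_inv_of_isUnit {n 𝕜 : Type*} [Fintype n] [DecidableEq n] [Field 𝕜]
    [TopologicalSpace 𝕜] [IsTopologicalDivisionRing 𝕜] {A : Matrix n n 𝕜} (hA : IsUnit A) :
    ContinuousAt (fun M : Matrix n n 𝕜 => M⁻¹) A := by
  have hdet : A.det ≠ 0 := ((Matrix.isUnit_iff_isUnit_det A).mp hA).ne_zero
  simp only [Matrix.inv_def, Ring.inverse_eq_inv']
  exact (continuous_id.matrix_det.continuousAt.inv₀ hdet).smul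
    continuous_id.matrix_adjugate.continuousAt

/-- The shifted Kronecker sum `c I + H ⊗ I + I ⊗ H` is positive definite for `c > 0` and `H`
positive semidefinite. -/
theorem Matrix.PosSemidef.posDef_smul_one_add_kronecker {n : Type*} [Fintype n] [DecidableEq n]
    {H : Matrix n n ℝ} (hH : H.PosSemidef) {c : ℝ} (hc : 0 < c) :
    (c • (1 : Matrix (n × n) (n × n) ℝ) + H ⊗ₖ (1 : Matrix n n ℝ)
      + (1 : Matrix n n ℝ) ⊗ₖ H).PosDef :=
  ((Matrix.PosDef.one.smul hc).add_posSemidef (hH.kronecker Matrix.PosSemidef.one)).add_posSemidef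
    (Matrix.PosSemidef.one.kronecker hH)

/-- Small step-size approximation of the asymptotic variance: with
`S(μ) = (1-μν)² I + (μ²/N)(Γ + (N-1) H⊗H) - μ(1-μν)(H⊗I + I⊗H)`,
the matrix `2νI + H⊗I + I⊗H` is invertible, `I - S(μ)` is invertible for all small
`μ > 0`, and `(1/μ) vᵀ(μ²(I - S(μ))⁻¹ q) → vᵀ(2νI + H⊗I + I⊗H)⁻¹ q` as `μ → 0⁺`. -/
theorem stmt_12 {L N : ℕ} (hL : 0 < L) (hN : 0 < N)
    (ν : ℝ) (hν : 0 < ν)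
    (H : Matrix (Fin L) (Fin L) ℝ) (hH : H.PosSemidef)
    (Γ : Matrix (Fin L × Fin L) (Fin L × Fin L) ℝ)
    (q v : Fin L × Fin L → ℝ)
    (S : ℝ → Matrix (Fin L × Fin L) (Fin L × Fin L) ℝ)
    (hS : ∀ μ : ℝ, S μ = (1 - μ*ν)^2 • (1 : Matrix (Fin L × Fin L) (Fin L × Fin L) ℝ)
        + (μ^2 / (N : ℝ)) • (Γ + ((N : ℝ) - 1) • (H ⊗ₖ H))
        - (μ * (1 - μ*ν)) • (H ⊗ₖ (1 : Matrix (Fin L) (Fin L) ℝ)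
            + (1 : Matrix (Fin L) (Fin L) ℝ) ⊗ₖ H))
    (A : Matrix (Fin L × Fin L) (Fin L × Fin L) ℝ)
    (hA : A = (2*ν) • (1 : Matrix (Fin L × Fin L) (Fin L × Fin L) ℝ)
        + H ⊗ₖ (1 : Matrix (Fin L) (Fin L) ℝ) + (1 : Matrix (Fin L) (Fin L) ℝ) ⊗ₖ H) :
    IsUnit A ∧
    (∃ μ₀ > (0:ℝ), ∀ μ : ℝ, 0 < μ → μ < μ₀ →
      IsUnit ((1 : Matrix (Fin L × Fin L) (Fin L × Fin L) ℝ) - S μ)) ∧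
    Tendsto (fun μ : ℝ => (1/μ) * (v ⬝ᵥ (μ^2 • (((1 : Matrix (Fin L × Fin L) (Fin L × Fin L) ℝ) - S μ)⁻¹ *ᵥ q))))
      (nhdsWithin 0 (Set.Ioi 0)) (nhds (v ⬝ᵥ (A⁻¹ *ᵥ q))) := by
  have hAu : IsUnit A := hA ▸ (hH.posDef_smul_one_add_kronecker (by positivity)).isUnit
  obtain ⟨B, hB⟩ : ∃ B : Matrix (Fin L × Fin L) (Fin L × Fin L) ℝ,
      ∀ μ : ℝ, 1 - S μ = μ • (A + μ • B) := by
    refine ⟨-(ν ^ 2) • 1 - (1 / (N : ℝ)) • (Γ + ((N : ℝ) - 1) • (H ⊗ₖ H))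
      - ν • (H ⊗ₖ (1 : Matrix (Fin L) (Fin L) ℝ) + (1 : Matrix (Fin L) (Fin L) ℝ) ⊗ₖ H),
      fun μ => ?_⟩
    rw [hS, hA]
    module
  have hcont : Continuous fun μ : ℝ => A + μ • B := by fun_prop
  have hunit : ∀ᶠ μ : ℝ in nhds 0, IsUnit (A + μ • B) := by
    have hdet : (A + (0 : ℝ) • B).det ≠ 0 := by
      simpa using ((Matrix.isUnit_iff_isUnit_det A).mp hAu).ne_zero
    filter_upwards [hcont.matrix_det.continuousAt.eventually_ne hdet] with μ hμ
    exact (Matrix.isUnit_iff_isUnit_det _).mpr hμ.isUnit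
  refine ⟨hAu, ?_, ?_⟩
  · obtain ⟨ε, hε, hball⟩ := Metric.eventually_nhds_iff.mp hunit
    refine ⟨ε, hε, fun μ hμ hμε => ?_⟩
    rw [hB]
    exact (hball (by simpa [abs_of_pos hμ] using hμε)).smul (Units.mk0 μ hμ.ne')
  · have hinv : Tendsto (fun μ : ℝ => (A + μ • B)⁻¹) (nhds 0) (nhds A⁻¹) :=
      (Matrix.continuousAt_inv_of_isUnit hAu).tendsto.comp (by simpa using hcont.tendsto 0)
    have hform : Continuous fun M : Matrix (Fin L × Fin L) (Fin L × Fin L) ℝ => v ⬝ᵥ (M *ᵥ q) := by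
      fun_prop
    refine (((hform.tendsto _).comp hinv).mono_left nhdsWithin_le_nhds).congr' ?_
    filter_upwards [self_mem_nhdsWithin, hunit.filter_mono nhdsWithin_le_nhds] with μ hμ hu
    have hμ0 : μ ≠ 0 := (Set.mem_Ioi.mp hμ).ne'
    have hsmul : (μ • (A + μ • B))⁻¹ = μ⁻¹ • (A + μ • B)⁻¹ :=
      Matrix.inv_smul' (A := A + μ • B) (Units.mk0 μ hμ0) ((Matrix.isUnit_iff_isUnit_det _).mp hu)
    simp only [Function.comp_apply, hB, hsmul, Matrix.smul_mulVec, dotProduct_smul, smul_eq_mul]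
    field_simp
end

section
/- Let k be a positive integer, let μ ∈ ℝ^k, let R be a real symmetric positive definite k×k matrix, and let y be a random vector in ℝ^k with the multivariate Gaussian distribution N(μ, R). Then for every σ > 0 and every a, b ∈ ℝ^k, setting c = (a + b)/2, the matrix (σ²/2)I + R is invertible and E[ exp( −(‖y − a‖² + ‖y − b‖²) / (2σ²) ) ] = exp( −‖a − b‖² / (4σ²) ) · det( I + 2σ⁻² R )^{−1/2} · exp( −½ (c − μ)ᵀ ( (σ²/2) I + R )⁻¹ (c − μ) ). -/
open MeasureTheory Matrix

open scoped MatrixOrder in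
theorem Matrix.PosDef.exists_det_ne_zero_eq_transpose_mul_self {n : Type*} [Fintype n]
    [DecidableEq n] {A : Matrix n n ℝ} (hA : A.PosDef) :
    ∃ B : Matrix n n ℝ, B.det ≠ 0 ∧ A = Bᵀ * B := by
  obtain ⟨B, rfl⟩ := CStarAlgebra.nonneg_iff_eq_star_mul_self.mp hA.posSemidef.nonneg
  refine ⟨B, fun h => hA.det_pos.ne' ?_, ?_⟩
  · rw [det_mul, h, mul_zero]
  · rw [star_eq_conjTranspose, conjTranspose_eq_transpose_of_trivial]

theorem MeasureTheory.integral_comp_mulVec {n : Type*} [Fintype n] [DecidableEq n]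
    {B : Matrix n n ℝ} (hB : B.det ≠ 0) (g : (n → ℝ) → ℝ) :
    ∫ x, g (B *ᵥ x) = |B.det|⁻¹ * ∫ x, g x := by
  have hemb : MeasurableEmbedding (Matrix.toLin' B) :=
    ((LinearEquiv.ofIsUnitDet (f := Matrix.toLin' B) (v := Pi.basisFun ℝ n)
      (v' := Pi.basisFun ℝ n) (by
        simpa [LinearMap.toMatrix_eq_toMatrix', isUnit_iff_ne_zero]
          using hB)).toContinuousLinearEquiv.toHomeomorph).measurableEmbedding
  have h := hemb.integral_map (μ := volume) g
  rw [Real.map_matrix_volume_pi_eq_smul_volume_pi hB, integral_smul_measure,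
    ENNReal.toReal_ofReal (abs_nonneg _), abs_inv, smul_eq_mul] at h
  simpa using h.symm

theorem integral_exp_neg_half_dotProduct_self {n : Type*} [Fintype n] :
    ∫ x : n → ℝ, Real.exp (-(1 / 2) * (x ⬝ᵥ x)) =
      √((2 * Real.pi) ^ Fintype.card n) := by
  have h (x : n → ℝ) : Real.exp (-(1 / 2) * (x ⬝ᵥ x)) =
      ∏ i, Real.exp (-(1 / 2) * x i ^ 2) := by
    rw [← Real.exp_sum, ← Finset.mul_sum]
    simp [dotProduct, sq]
  simp_rw [h]
  rw [integral_fintype_prod_volume_eq_pow fun t : ℝ => Real.exp (-(1 / 2) * t ^ 2),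
    integral_gaussian, Real.sqrt_eq_rpow, Real.sqrt_eq_rpow,
    Real.rpow_pow_comm (by positivity)]
  congr 2
  ring

theorem Matrix.PosDef.integral_exp_neg_half_dotProduct_mulVec {n : Type*} [Fintype n]
    [DecidableEq n] {A : Matrix n n ℝ} (hA : A.PosDef) :
    ∫ x : n → ℝ, Real.exp (-(1 / 2) * (x ⬝ᵥ (A *ᵥ x))) =
      √((2 * Real.pi) ^ Fintype.card n) * (√A.det)⁻¹ := by
  obtain ⟨B, hB, rfl⟩ := hA.exists_det_ne_zero_eq_transpose_mul_self
  have h (x : n → ℝ) : x ⬝ᵥ ((Bᵀ * B) *ᵥ x) = (B *ᵥ x) ⬝ᵥ (B *ᵥ x) := by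
    rw [← mulVec_mulVec, dotProduct_mulVec, vecMul_transpose]
  simp_rw [h]
  rw [integral_comp_mulVec hB (fun x => Real.exp (-(1 / 2) * (x ⬝ᵥ x))),
    integral_exp_neg_half_dotProduct_self, det_mul, det_transpose, Real.sqrt_mul_self_eq_abs,
    mul_comm]

/-- Completing the square for the sum of the quadratic forms of `R⁻¹` and `s • 1`, centred at
`0` and at `s⁻¹ • u + R *ᵥ u` respectively. -/
theorem Matrix.complete_square_inv_add_smul_one {n : Type*} [Fintype n] [DecidableEq n]
    {R : Matrix n n ℝ} (hR : R.IsSymm) (hdet : IsUnit R.det) {s : ℝ} (hs : s ≠ 0)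
    (x u : n → ℝ) :
    x ⬝ᵥ (R⁻¹ *ᵥ x) + s * ((x - (s⁻¹ • u + R *ᵥ u)) ⬝ᵥ (x - (s⁻¹ • u + R *ᵥ u))) =
      (x - R *ᵥ u) ⬝ᵥ ((R⁻¹ + s • 1) *ᵥ (x - R *ᵥ u)) + (s⁻¹ • u + R *ᵥ u) ⬝ᵥ u := by
  have hm : R⁻¹ *ᵥ (R *ᵥ u) = u := by
    rw [mulVec_mulVec, nonsing_inv_mul _ hdet, one_mulVec]
  have hx : (R *ᵥ u) ⬝ᵥ (R⁻¹ *ᵥ x) = x ⬝ᵥ u := by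
    rw [dotProduct_mulVec, ← mulVec_transpose, transpose_nonsing_inv, hR.eq, hm, dotProduct_comm]
  simp only [add_mulVec, smul_mulVec, one_mulVec, mulVec_sub, hm, dotProduct_add, add_dotProduct,
    sub_dotProduct, dotProduct_sub, hx, dotProduct_smul, smul_dotProduct, smul_eq_mul,
    dotProduct_comm u x, dotProduct_comm (R *ᵥ u) x, dotProduct_comm (R *ᵥ u) u]
  field_simp
  ring

/-- Gaussian-kernel second-moment entry: for `y ~ N(μ, R)` (encoded by its density with
respect to Lebesgue measure) and `c = (a+b)/2`, the matrix `(σ²/2)I + R` is invertible and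
`E[exp(-(‖y-a‖² + ‖y-b‖²)/(2σ²))] = exp(-‖a-b‖²/(4σ²)) det(I + 2σ⁻²R)^{-1/2}
  exp(-½ (c-μ)ᵀ((σ²/2)I + R)⁻¹(c-μ))`. -/
theorem stmt_18 {k : ℕ} (hk : 0 < k)
    (μ : Fin k → ℝ) (R : Matrix (Fin k) (Fin k) ℝ) (hR : R.PosDef)
    (P : Measure (Fin k → ℝ))
    (hP : P = volume.withDensity (fun y => ENNReal.ofReal
      (((2 * Real.pi) ^ (k : ℝ) * R.det) ^ (-(1/2 : ℝ))
        * Real.exp (-(1/2) * ((y - μ) ⬝ᵥ (R⁻¹ *ᵥ (y - μ))))))) :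
    ∀ (σ : ℝ), 0 < σ → ∀ a b : Fin k → ℝ, ∀ c : Fin k → ℝ, c = (1/2 : ℝ) • (a + b) →
      IsUnit ((σ^2/2) • (1 : Matrix (Fin k) (Fin k) ℝ) + R) ∧
      ∫ y, Real.exp (-(((y - a) ⬝ᵥ (y - a)) + ((y - b) ⬝ᵥ (y - b))) / (2 * σ^2)) ∂P
        = Real.exp (-((a - b) ⬝ᵥ (a - b)) / (4 * σ^2))
          * ((1 : Matrix (Fin k) (Fin k) ℝ) + (2 * (σ^2)⁻¹) • R).det ^ (-(1/2 : ℝ))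
          * Real.exp (-(1/2) * ((c - μ) ⬝ᵥ
              (((σ^2/2) • (1 : Matrix (Fin k) (Fin k) ℝ) + R)⁻¹ *ᵥ (c - μ)))) := by
  intro σ hσ a b c hc
  set s : ℝ := 2 * (σ ^ 2)⁻¹ with hs
  have hs0 : 0 < s := by positivity
  have hsinv : σ ^ 2 / 2 = s⁻¹ := by rw [hs]; field_simp
  rw [hsinv]
  have hT : (s⁻¹ • (1 : Matrix (Fin k) (Fin k) ℝ) + R).PosDef :=
    (PosDef.one.smul (inv_pos.2 hs0)).add hR
  have hA : (R⁻¹ + s • (1 : Matrix (Fin k) (Fin k) ℝ)).PosDef :=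
    hR.inv.add (PosDef.one.smul hs0)
  refine ⟨hT.isUnit, ?_⟩
  have hRdet : IsUnit R.det := hR.det_pos.ne'.isUnit
  set T := s⁻¹ • (1 : Matrix (Fin k) (Fin k) ℝ) + R with hTdef
  set A := R⁻¹ + s • (1 : Matrix (Fin k) (Fin k) ℝ) with hAdef
  have hdet : (1 + s • R).det = R.det * A.det := by
    rw [← det_mul, hAdef, mul_add, mul_nonsing_inv _ hRdet, Matrix.mul_smul, Matrix.mul_one]
  set u := T⁻¹ *ᵥ (c - μ) with hu
  have hd : s⁻¹ • u + R *ᵥ u = c - μ := by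
    have h : T *ᵥ u = c - μ := by
      rw [hu, mulVec_mulVec, mul_nonsing_inv _ hT.det_pos.ne'.isUnit, one_mulVec]
    rw [← h, hTdef, add_mulVec, smul_mulVec, one_mulVec]
  have hsplit (y : Fin k → ℝ) :
      -((y - a) ⬝ᵥ (y - a) + (y - b) ⬝ᵥ (y - b)) / (2 * σ ^ 2) =
        -((a - b) ⬝ᵥ (a - b)) / (4 * σ ^ 2) +
          -(1 / 2) * (s * ((y - c) ⬝ᵥ (y - c))) := by
    rw [hs, hc]
    simp only [sub_dotProduct, dotProduct_sub, smul_dotProduct, dotProduct_smul, smul_eq_mul,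
      dotProduct_add, add_dotProduct, dotProduct_comm a y, dotProduct_comm b y,
      dotProduct_comm b a]
    field_simp
    ring
  have hsquare (y : Fin k → ℝ) :
      (y - μ) ⬝ᵥ (R⁻¹ *ᵥ (y - μ)) + s * ((y - c) ⬝ᵥ (y - c)) =
        (y - (μ + R *ᵥ u)) ⬝ᵥ (A *ᵥ (y - (μ + R *ᵥ u))) + (c - μ) ⬝ᵥ u := by
    have h := complete_square_inv_add_smul_one (R := R)
      (by simpa [IsHermitian, IsSymm] using hR.isHermitian) hRdet hs0.ne' (y - μ) u
    rwa [hd, sub_sub_sub_cancel_right, sub_sub] at h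
  set C := ((2 * Real.pi) ^ (k : ℝ) * R.det) ^ (-(1 / 2 : ℝ)) with hC
  have hC0 : 0 ≤ C := Real.rpow_nonneg (mul_nonneg (by positivity) hR.det_pos.le) _
  have hpoint (y : Fin k → ℝ) :
      C * Real.exp (-(1 / 2) * ((y - μ) ⬝ᵥ (R⁻¹ *ᵥ (y - μ)))) *
        Real.exp (-((y - a) ⬝ᵥ (y - a) + (y - b) ⬝ᵥ (y - b)) / (2 * σ ^ 2)) =
      C * Real.exp (-((a - b) ⬝ᵥ (a - b)) / (4 * σ ^ 2)) *
        Real.exp (-(1 / 2) * ((c - μ) ⬝ᵥ u)) *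
        Real.exp (-(1 / 2) * ((y - (μ + R *ᵥ u)) ⬝ᵥ (A *ᵥ (y - (μ + R *ᵥ u))))) := by
    simp only [mul_assoc, ← Real.exp_add]
    rw [hsplit]
    congr 2
    linear_combination -(1 / 2) * hsquare y
  rw [hP, integral_withDensity_eq_integral_toReal_smul (by fun_prop) (by simp)]
  have hnn (y : Fin k → ℝ) :
      0 ≤ C * Real.exp (-(1 / 2) * ((y - μ) ⬝ᵥ (R⁻¹ *ᵥ (y - μ)))) := by positivity
  simp_rw [ENNReal.toReal_ofReal (hnn _), smul_eq_mul, hpoint]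
  rw [integral_const_mul,
    integral_sub_right_eq_self (fun x => Real.exp (-(1 / 2) * (x ⬝ᵥ (A *ᵥ x)))) (μ + R *ᵥ u),
    hA.integral_exp_neg_half_dotProduct_mulVec, Fintype.card_fin, hdet]
  have hconst : C * √((2 * Real.pi) ^ k) * (√A.det)⁻¹ =
      (R.det * A.det) ^ (-(1 / 2 : ℝ)) := by
    have hpi : √((2 * Real.pi) ^ k) ≠ 0 := by positivity
    rw [hC, Real.rpow_neg (mul_nonneg (by positivity) hR.det_pos.le),
      Real.rpow_neg (mul_nonneg hR.det_pos.le hA.det_pos.le), ← Real.sqrt_eq_rpow,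
      ← Real.sqrt_eq_rpow, Real.rpow_natCast, Real.sqrt_mul (by positivity),
      Real.sqrt_mul hR.det_pos.le]
    field_simp
  rw [← hconst]
  ring
end
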